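/- arXiv:1003.4866 — 2 statements merged into one kernel-verified Lean document; each statement's English description precedes it below -/
import Mathlib

section
/- Assume that every word u of length n over a finite alphabet contains at most 1.029·n runs (the bound of Crochemore, Ilie and Tinta). Then for every word u of length n ≥ 1, the sum of the exponents of all runs in u is strictly less than 4.1·n. -/
open scoped Classical

namespace RunsExp

variable {α : Type*}

/-- `p` is a period of the word `w`. -/
def IsPeriod (w : List α) (p : ℕ) : Prop :=
  0 < p ∧ ∀ i : ℕ, i + p < w.length → w[i]? = w[i + p]?

/-- The shortest period of the word `w`. -/
noncomputable def minPeriod (w : List α) : ℕ := sInf {p | IsPeriod w p}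

/-- The factor `u[i..j]` of `u` (0-based indices, inclusive on both ends). -/
def factor (u : List α) (i j : ℕ) : List α := (u.drop i).take (j - i + 1)

/-- `[i..j]` is a run in `u` (0-based indices): the shortest period `p` of `u[i..j]`
satisfies `2p ≤ j-i+1` and the interval can be extended neither to the left nor to
the right without violating this property. -/
def IsRun (u : List α) (i j : ℕ) : Prop :=
  i ≤ j ∧ j < u.length ∧
  2 * minPeriod (factor u i j) ≤ j - i + 1 ∧
  (i = 0 ∨ u[i - 1]? ≠ u[i + minPeriod (factor u i j) - 1]?) ∧
  (j = u.length - 1 ∨ u[j - minPeriod (factor u i j) + 1]? ≠ u[j + 1]?)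

/-- The exponent of the run `[i..j]` of `u`. -/
noncomputable def exponent (u : List α) (i j : ℕ) : ℚ :=
  ((j : ℚ) - (i : ℚ) + 1) / (minPeriod (factor u i j) : ℚ)

/-- The set of all runs of `u`, as a finset of pairs of indices. -/
noncomputable def runs (u : List α) : Finset (ℕ × ℕ) :=
  (Finset.range u.length ×ˢ Finset.range u.length).filter fun q => IsRun u q.1 q.2

/-- The sum of exponents of all runs in `u`. -/
noncomputable def sigma (u : List α) : ℚ :=
  ∑ q ∈ runs u, exponent u q.1 q.2

/-- The lexicographically minimal word cyclically equivalent to `w`. -/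
noncomputable def minRot [LinearOrder α] (w : List α) : List α :=
  ((List.range w.length).map w.rotate).foldr min w

/-- The lexicographically maximal word cyclically equivalent to `w`. -/
noncomputable def maxRot [LinearOrder α] (w : List α) : List α :=
  ((List.range w.length).map w.rotate).foldr max w

/-- The word `x` occurs in `u` at (0-based) starting position `s`, entirely within
the interval `[i..j]`. -/
def OccursAt (u : List α) (i j : ℕ) (x : List α) (s : ℕ) : Prop :=
  i ≤ s ∧ s + x.length ≤ j + 1 ∧ factor u s (s + x.length - 1) = x

/-- `s` and `s'` are starting positions of consecutive occurrences of `x`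
inside the interval `[i..j]` of `u`. -/
def ConsecutiveOcc (u : List α) (i j : ℕ) (x : List α) (s s' : ℕ) : Prop :=
  OccursAt u i j x s ∧ OccursAt u i j x s' ∧ s < s' ∧
    ∀ t, s < t → t < s' → ¬ OccursAt u i j x t

/-- The set of handles of the run `[i..j]` of `u`: inter-position `k` lies between
the letters at positions `k` and `k+1`.  If the minimal and maximal rotations of the
period-prefix `w` coincide, all inter-positions inside the run are handles; otherwise
the handles are the inter-positions between consecutive occurrences of the minimal
rotation and between consecutive occurrences of the maximal rotation. -/
noncomputable def handles [LinearOrder α] (u : List α) (i j : ℕ) : Set ℕ :=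
  let p := minPeriod (factor u i j)
  let w := factor u i (i + p - 1)
  if minRot w = maxRot w then
    {k | i ≤ k ∧ k < j}
  else
    {k | ∃ s s', (ConsecutiveOcc u i j (minRot w) s s' ∨
                  ConsecutiveOcc u i j (maxRot w) s s') ∧ k = s' - 1}

/-- `[i..j]` is a cubic run in `u`. -/
def IsCubicRun (u : List α) (i j : ℕ) : Prop :=
  IsRun u i j ∧ 3 * minPeriod (factor u i j) ≤ j - i + 1

/-- The set of all cubic runs of `u`. -/
noncomputable def cubicRuns (u : List α) : Finset (ℕ × ℕ) :=
  (Finset.range u.length ×ˢ Finset.range u.length).filter fun q => IsCubicRun u q.1 q.2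

/-- The sum of exponents of all cubic runs in `u`. -/
noncomputable def sigmaCubic (u : List α) : ℚ :=
  ∑ q ∈ cubicRuns u, exponent u q.1 q.2



section Aux

variable {β : Type*} [LinearOrder β]

/-- The (infinite) suffix of `f` starting at `s`, with lexicographic order. -/
def suf (f : ℕ → β) (s : ℕ) : Lex (ℕ → β) := toLex (fun k => f (s + k))

theorem suf_lt_iff (f : ℕ → β) (s t : ℕ) :
    suf f s < suf f t ↔ ∃ d, (∀ e < d, f (s + e) = f (t + e)) ∧ f (s + d) < f (t + d) :=
  Iff.rfl

theorem suf_eq_iff (f : ℕ → β) (s t : ℕ) :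
    suf f s = suf f t ↔ ∀ k, f (s + k) = f (t + k) := by
  constructor
  · intro h k
    exact congrFun h k
  · intro h
    exact funext h

/-- `s + p` is the next position after `s` with smaller suffix. -/
def NSS (f : ℕ → β) (s p : ℕ) : Prop :=
  0 < p ∧ suf f (s + p) < suf f s ∧ ∀ t, s < t → t < s + p → suf f s < suf f t

theorem NSS.unique {f : ℕ → β} {s p q : ℕ} (h : NSS f s p) (h' : NSS f s q) : p = q := by
  obtain ⟨hp, h1, h2⟩ := h
  obtain ⟨hq, h3, h4⟩ := h'
  rcases lt_trichotomy p q with hl | hl | hl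
  · exact absurd h1 (not_lt_of_gt (h4 (s + p) (by omega) (by omega)))
  · exact hl
  · exact absurd h3 (not_lt_of_gt (h2 (s + q) (by omega) (by omega)))

theorem suf_lt_drop {f : ℕ → β} {s t : ℕ} (m : ℕ) (h : suf f s < suf f t)
    (he : ∀ e < m, f (s + e) = f (t + e)) : suf f (s + m) < suf f (t + m) := by
  rw [suf_lt_iff] at h ⊢
  obtain ⟨d, h1, h2⟩ := h
  have hd : m ≤ d := by
    by_contra hlt
    exact absurd (he d (by omega)) h2.ne
  refine ⟨d - m, fun e hed => ?_, ?_⟩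
  · have := h1 (m + e) (by omega)
    simpa [add_assoc] using this
  · have e1 : s + m + (d - m) = s + d := by omega
    have e2 : t + m + (d - m) = t + d := by omega
    rw [e1, e2]; exact h2

theorem NSS.not_border {f : ℕ → β} {s p : ℕ} (h : NSS f s p) (hp : 1 < p)
    (hb : f s = f (s + p - 1)) : False := by
  obtain ⟨_, h1, h2⟩ := h
  have h3 := h2 (s + p - 1) (by omega) (by omega)
  have h4 := suf_lt_drop 1 h3 (by
    intro e he
    have : e = 0 := by omega
    subst this
    simpa using hb)
  have e1 : s + p - 1 + 1 = s + p := by omega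
  rw [e1] at h4
  exact absurd (h4.trans h1) (not_lt_of_gt (h2 (s + 1) (by omega) (by omega)))

theorem exists_NSS (f : ℕ → β) (p L a : ℕ) (hp : 0 < p)
    (hper : ∀ k, k + p < L → f k = f (k + p))
    (hmin : ∀ q, 0 < q → q < p → ¬ ∀ k, k + q < L → f k = f (k + q))
    (hend : f L < f (L - p)) (ha : a + 2 * p ≤ L + 1) :
    ∃ s, a ≤ s ∧ s < a + p ∧ NSS f s p := by
  set g : ℕ → β := fun k => f (k % p) with hg
  have gper : ∀ k, g (k + p) = g k := fun k => by simp [hg]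
  have gperm : ∀ m k, g (k + m * p) = g k := fun m k => by simp [hg]
  have fg : ∀ k, k < L → f k = g k := by
    intro k
    induction k using Nat.strong_induction_on with
    | _ k ih =>
      intro hk
      by_cases hkp : k < p
      · simp [hg, Nat.mod_eq_of_lt hkp]
      · have h1 := hper (k - p) (by omega)
        have h2 := ih (k - p) (by omega) (by omega)
        have h3 := gper (k - p)
        have e : k - p + p = k := by omega
        rw [e] at h1 h3
        rw [← h1, h2, h3]
  have sufper : ∀ k, suf g (k + p) = suf g k := fun k => by
    rw [suf_eq_iff]
    intro l
    have := gper (k + l)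
    rwa [show k + p + l = k + l + p by omega]
  obtain ⟨s, hs, hsmin⟩ := Finset.exists_min_image (Finset.Ico a (a + p)) (suf g)
    ⟨a, by simp; omega⟩
  rw [Finset.mem_Ico] at hs
  have smin' : ∀ t, s ≤ t → t < s + p → suf g s ≤ suf g t := by
    intro t h1 h2
    by_cases h3 : t < a + p
    · exact hsmin t (by rw [Finset.mem_Ico]; omega)
    · have := sufper (t - p)
      rw [show t - p + p = t by omega] at this
      rw [this]
      exact hsmin (t - p) (by rw [Finset.mem_Ico]; omega)
  have sstrict : ∀ t, s < t → t < s + p → suf g s < suf g t := by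
    intro t h1 h2
    refine lt_of_le_of_ne (smin' t h1.le h2) ?_
    intro heq
    rw [suf_eq_iff] at heq
    apply hmin (t - s) (by omega) (by omega)
    intro k hk
    rw [fg k (by omega), fg _ hk, ← gperm s k, ← gperm s (k + (t - s))]
    have hsp : s ≤ s * p := Nat.le_mul_of_pos_right s hp
    have := heq (k + s * p - s)
    rw [show s + (k + s * p - s) = k + s * p by omega,
      show t + (k + s * p - s) = k + (t - s) + s * p by omega] at this
    exact this
  refine ⟨s, hs.1, hs.2, hp, ?_, ?_⟩
  · rw [suf_lt_iff]
    refine ⟨L - p - s, ?_, ?_⟩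
    · intro e he
      have := hper (s + e) (by omega)
      rw [show s + p + e = s + e + p by omega, this]
    · rw [show s + p + (L - p - s) = L by omega, show s + (L - p - s) = L - p by omega]
      exact hend
  · intro t h1 h2
    have h3 := sstrict t h1 h2
    have h3' := h3
    rw [suf_lt_iff] at h3'
    obtain ⟨d, hd1, hd2⟩ := h3'
    have hdlt : t + d < s + p := by
      by_contra hge
      have h4 := suf_lt_drop (s + p - t) h3 (fun e he => hd1 e (by omega))
      rw [show t + (s + p - t) = s + p by omega, sufper] at h4
      exact absurd h4 (not_lt_of_ge (smin' _ (by omega) (by omega)))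
    rw [suf_lt_iff]
    refine ⟨d, ?_, ?_⟩
    · intro e he
      rw [fg _ (by omega), fg _ (by omega)]
      exact hd1 e he
    · rw [fg _ (by omega), fg _ (by omega)]
      exact hd2

theorem exists_NSS_shift (f : ℕ → β) (i p L a : ℕ) (hp : 0 < p)
    (hper : ∀ k, k + p < L → f (i + k) = f (i + (k + p)))
    (hmin : ∀ q, 0 < q → q < p → ¬ ∀ k, k + q < L → f (i + k) = f (i + (k + q)))
    (hend : f (i + L) < f (i + (L - p))) (ha : a + 2 * p ≤ L + 1) :
    ∃ s, a ≤ s ∧ s < a + p ∧ NSS f (i + s) p := by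
  obtain ⟨s, h1, h2, h3, h4, h5⟩ :=
    exists_NSS (fun k => f (i + k)) p L a hp hper hmin hend ha
  have hs : ∀ t, suf (fun k => f (i + k)) t = suf f (i + t) := by
    intro t
    rw [suf, suf]
    simp [add_assoc]
  refine ⟨s, h1, h2, h3, ?_, ?_⟩
  · rw [hs, hs] at h4
    rwa [add_assoc]
  · intro t ht1 ht2
    have := h5 (t - i) (by omega) (by omega)
    rw [hs, hs, show i + (t - i) = t by omega] at this
    exact this

end Aux

section Words

/-- Letters of `u` with an end marker below all letters. -/
def f0 (u : List α) (k : ℕ) : WithBot α := u[k]?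

/-- Letters of `u` in the reversed order with an end marker below all letters. -/
def f1 (u : List α) (k : ℕ) : WithBot αᵒᵈ := u[k]?

theorem f0_eq (u : List α) (k l : ℕ) : f0 u k = f0 u l ↔ u[k]? = u[l]? := Iff.rfl

theorem f1_eq (u : List α) (k l : ℕ) : f1 u k = f1 u l ↔ u[k]? = u[l]? := Iff.rfl

theorem f01_lt [LinearOrder α] (u : List α) (k l : ℕ) (hl : l < u.length)
    (h : u[k]? ≠ u[l]?) : f0 u k < f0 u l ∨ f1 u k < f1 u l := by
  by_cases hk : k < u.length
  · have a0 : f0 u k = ((u[k] : α) : WithBot α) := List.getElem?_eq_getElem hk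
    have b0 : f0 u l = ((u[l] : α) : WithBot α) := List.getElem?_eq_getElem hl
    have a1 : f1 u k = ((OrderDual.toDual u[k] : αᵒᵈ) : WithBot αᵒᵈ) := List.getElem?_eq_getElem hk
    have b1 : f1 u l = ((OrderDual.toDual u[l] : αᵒᵈ) : WithBot αᵒᵈ) := List.getElem?_eq_getElem hl
    rw [a0, b0, a1, b1, WithBot.coe_lt_coe, WithBot.coe_lt_coe, OrderDual.toDual_lt_toDual]
    apply lt_or_gt_of_ne
    intro h'
    apply h
    rw [List.getElem?_eq_getElem hk, List.getElem?_eq_getElem hl, h']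
  · left
    have a0 : f0 u k = (⊥ : WithBot α) := List.getElem?_eq_none (by omega)
    have b0 : f0 u l = ((u[l] : α) : WithBot α) := List.getElem?_eq_getElem hl
    rw [a0, b0]
    exact WithBot.bot_lt_coe _

theorem f01_not_both [LinearOrder α] (u : List α) (k : ℕ)
    (h0 : f0 u k < f0 u (k + 1)) (h1 : f1 u k < f1 u (k + 1)) : False := by
  by_cases hl : k + 1 < u.length
  · have hk : k < u.length := by omega
    have a0 : f0 u k = ((u[k] : α) : WithBot α) := List.getElem?_eq_getElem hk
    have b0 : f0 u (k+1) = ((u[k+1] : α) : WithBot α) := List.getElem?_eq_getElem hl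
    have a1 : f1 u k = ((OrderDual.toDual u[k] : αᵒᵈ) : WithBot αᵒᵈ) := List.getElem?_eq_getElem hk
    have b1 : f1 u (k+1) = ((OrderDual.toDual u[k+1] : αᵒᵈ) : WithBot αᵒᵈ) :=
      List.getElem?_eq_getElem hl
    rw [a0, b0, WithBot.coe_lt_coe] at h0
    rw [a1, b1, WithBot.coe_lt_coe, OrderDual.toDual_lt_toDual] at h1
    exact lt_asymm h0 h1
  · have b0 : f0 u (k+1) = (⊥ : WithBot α) := List.getElem?_eq_none (by omega)
    rw [b0] at h0
    exact not_lt_bot h0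

theorem suf01_not_both [LinearOrder α] (u : List α) (s : ℕ)
    (h0 : suf (f0 u) s < suf (f0 u) (s + 1)) (h1 : suf (f1 u) s < suf (f1 u) (s + 1)) :
    False := by
  rw [suf_lt_iff] at h0 h1
  obtain ⟨d, hd, hd'⟩ := h0
  obtain ⟨e, he, he'⟩ := h1
  have hde : d = e := by
    rcases lt_trichotomy d e with hl | hl | hl
    · exact absurd ((f0_eq u _ _).2 ((f1_eq u _ _).1 (he d hl))) hd'.ne
    · exact hl
    · exact absurd ((f1_eq u _ _).2 ((f0_eq u _ _).1 (hd e hl))) he'.ne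
  subst hde
  rw [show s + 1 + d = s + d + 1 by omega] at hd' he'
  exact f01_not_both u _ hd' he'

theorem factor_length (u : List α) (i j : ℕ) (hij : i ≤ j) (hj : j < u.length) :
    (factor u i j).length = j - i + 1 := by
  simp [factor]; omega

theorem factor_get (u : List α) (i j k : ℕ) (hk : k < j - i + 1) :
    (factor u i j)[k]? = u[i + k]? := by
  simp [factor, List.getElem?_take, List.getElem?_drop, hk]

theorem isPeriod_factor (u : List α) (i j q : ℕ) (hij : i ≤ j) (hj : j < u.length) :
    IsPeriod (factor u i j) q ↔
      0 < q ∧ ∀ k, k + q < j - i + 1 → u[i + k]? = u[i + (k + q)]? := by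
  rw [IsPeriod, factor_length u i j hij hj]
  refine and_congr_right fun _ => forall_congr' fun k => ?_
  refine forall_congr' fun hk => ?_
  rw [factor_get u i j k (by omega), factor_get u i j _ hk]

/-- The unpacked description of a run with period `p`. -/
structure RunP (u : List α) (i j p : ℕ) : Prop where
  hij : i ≤ j
  hj : j < u.length
  hp : 0 < p
  hlen : 2 * p ≤ j - i + 1
  per : ∀ k, k + p < j - i + 1 → u[i + k]? = u[i + (k + p)]?
  min : ∀ q, 0 < q → q < p → ¬ ∀ k, k + q < j - i + 1 → u[i + k]? = u[i + (k + q)]?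
  left : i = 0 ∨ u[i - 1]? ≠ u[i + p - 1]?
  right : j = u.length - 1 ∨ u[j - p + 1]? ≠ u[j + 1]?

theorem IsRun.runP {u : List α} {i j : ℕ} (h : IsRun u i j) :
    RunP u i j (minPeriod (factor u i j)) := by
  obtain ⟨h1, h2, h3, h4, h5⟩ := h
  have hne : {p | IsPeriod (factor u i j) p}.Nonempty := by
    refine ⟨j - i + 1, ?_⟩
    rw [Set.mem_setOf_eq, isPeriod_factor u i j _ h1 h2]
    exact ⟨by omega, fun k hk => by omega⟩
  have hmem : IsPeriod (factor u i j) (minPeriod (factor u i j)) := Nat.sInf_mem hne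
  have hmem' := (isPeriod_factor u i j _ h1 h2).1 hmem
  refine ⟨h1, h2, hmem'.1, h3, hmem'.2, ?_, h4, h5⟩
  intro q hq hqp hall
  exact Nat.notMem_of_lt_sInf hqp ((isPeriod_factor u i j _ h1 h2).2 ⟨hq, hall⟩)

theorem RunP.per' {u : List α} {i j p : ℕ} (h : RunP u i j p) (k : ℕ) (hi : i ≤ k)
    (hk : k + p ≤ j) : u[k]? = u[k + p]? := by
  have := h.per (k - i) (by omega)
  rwa [show i + (k - i) = k by omega, show i + (k - i + p) = k + p by omega] at this

theorem RunP.eq_aux {u : List α} {i j i' j' p s : ℕ} (h : RunP u i j p) (h' : RunP u i' j' p)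
    (hs : i < s) (hs' : i' < s) (he : s + p ≤ j + 1) (he' : s + p ≤ j' + 1) :
    i' ≤ i ∧ j' ≤ j := by
  constructor
  · by_contra hlt
    rcases h'.left with h0 | h0
    · omega
    · apply h0
      have := h.per' (i' - 1) (by omega) (by omega)
      rwa [show i' - 1 + p = i' + p - 1 by omega] at this
  · by_contra hlt
    have hj' := h'.hj
    rcases h.right with h0 | h0
    · omega
    · apply h0
      have := h'.per' (j - p + 1) (by omega) (by omega)
      rwa [show j - p + 1 + p = j + 1 by omega] at this

/-- Root positions of a run. -/
noncomputable def B [LinearOrder α] (u : List α) (q : ℕ × ℕ) : Finset ℕ :=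
  (Finset.range u.length).filter fun s =>
    q.1 < s ∧ s + minPeriod (factor u q.1 q.2) ≤ q.2 + 1 ∧
      (NSS (f0 u) s (minPeriod (factor u q.1 q.2)) ∨ NSS (f1 u) s (minPeriod (factor u q.1 q.2)))

theorem same_period [LinearOrder α] {u : List α} {i j i' j' p p' s : ℕ}
    (h : RunP u i j p) (h' : RunP u i' j' p')
    (hs : i < s) (hs' : i' < s) (he : s + p ≤ j + 1) (he' : s + p' ≤ j' + 1)
    (h0 : NSS (f0 u) s p) (h1 : NSS (f1 u) s p') : p = p' := by
  have hp := h.hp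
  have hp' := h'.hp
  have e := h.per' (s - 1) (by omega) (by omega)
  have e' := h'.per' (s - 1) (by omega) (by omega)
  by_cases c : p = 1
  · by_cases c' : p' = 1
    · omega
    · exfalso
      refine h1.not_border (by omega) ((f1_eq u _ _).2 ?_)
      rw [c, show s - 1 + 1 = s by omega] at e
      rw [show s - 1 + p' = s + p' - 1 by omega] at e'
      rw [← e, e']
  · by_cases c' : p' = 1
    · exfalso
      refine h0.not_border (by omega) ((f0_eq u _ _).2 ?_)
      rw [c', show s - 1 + 1 = s by omega] at e'
      rw [show s - 1 + p = s + p - 1 by omega] at e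
      rw [← e', e]
    · exact (suf01_not_both u s (h0.2.2 (s + 1) (by omega) (by omega))
        (h1.2.2 (s + 1) (by omega) (by omega))).elim

theorem B_disjoint [LinearOrder α] (u : List α) (q r : ℕ × ℕ) (hq : IsRun u q.1 q.2)
    (hr : IsRun u r.1 r.2) (s : ℕ) (h1 : s ∈ B u q) (h2 : s ∈ B u r) : q = r := by
  have hq' := hq.runP
  have hr' := hr.runP
  rw [B, Finset.mem_filter] at h1 h2
  obtain ⟨_, a1, a2, a3⟩ := h1
  obtain ⟨_, b1, b2, b3⟩ := h2
  have hpp : minPeriod (factor u q.1 q.2) = minPeriod (factor u r.1 r.2) := by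
    rcases a3 with a3 | a3 <;> rcases b3 with b3 | b3
    · exact a3.unique b3
    · exact same_period hq' hr' a1 b1 a2 b2 a3 b3
    · exact (same_period hr' hq' b1 a1 b2 a2 b3 a3).symm
    · exact a3.unique b3
  rw [← hpp] at hr' b2
  have c1 := hq'.eq_aux hr' a1 b1 a2 b2
  have c2 := hr'.eq_aux hq' b1 a1 b2 a2
  ext <;> omega

theorem B_card [LinearOrder α] (u : List α) (i j : ℕ) (h : IsRun u i j) :
    (j - i + 1) / minPeriod (factor u i j) - 1 ≤ (B u (i, j)).card := by
  have h' := h.runP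
  set p := minPeriod (factor u i j) with hpdef
  have hp := h'.hp
  have hlen := h'.hlen
  have hj := h'.hj
  have hij := h'.hij
  have key : ∀ a, a + 2 * p ≤ j - i + 1 + 1 →
      ∃ s, a ≤ s ∧ s < a + p ∧ (NSS (f0 u) (i + s) p ∨ NSS (f1 u) (i + s) p) := by
    intro a ha
    have hne : u[i + (j - i + 1)]? ≠ u[i + (j - i + 1 - p)]? := by
      rw [show i + (j - i + 1) = j + 1 by omega, show i + (j - i + 1 - p) = j - p + 1 by omega]
      rcases h'.right with h0 | h0
      · rw [List.getElem?_eq_none (by omega), List.getElem?_eq_getElem (by omega)]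
        simp
      · exact h0.symm
    rcases f01_lt u _ _ (by omega) hne with hl | hl
    · obtain ⟨s, h1, h2, h3⟩ := exists_NSS_shift (f0 u) i p (j - i + 1) a hp h'.per h'.min hl ha
      exact ⟨s, h1, h2, Or.inl h3⟩
    · obtain ⟨s, h1, h2, h3⟩ := exists_NSS_shift (f1 u) i p (j - i + 1) a hp h'.per h'.min hl ha
      exact ⟨s, h1, h2, Or.inr h3⟩
  have hm : ∀ m, m < (j - i + 1) / p - 1 → (m + 2) * p ≤ j - i + 1 := by
    intro m hm
    calc (m + 2) * p ≤ (j - i + 1) / p * p := Nat.mul_le_mul_right _ (by omega)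
      _ ≤ _ := Nat.div_mul_le_self _ _
  have key2 : ∀ m, ∃ s, m < (j - i + 1) / p - 1 →
      (1 + m * p ≤ s ∧ s < 1 + m * p + p ∧ (NSS (f0 u) (i + s) p ∨ NSS (f1 u) (i + s) p)) := by
    intro m
    by_cases hmm : m < (j - i + 1) / p - 1
    · have := hm m hmm
      obtain ⟨s, hs⟩ := key (1 + m * p) (by nlinarith)
      exact ⟨s, fun _ => hs⟩
    · exact ⟨0, fun hh => absurd hh hmm⟩
  choose S hS using key2
  have : (Finset.range ((j - i + 1) / p - 1)).card ≤ (B u (i, j)).card := by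
    apply Finset.card_le_card_of_injOn (fun m => i + S m)
    · intro m hmm
      have hmm' : m < (j - i + 1) / p - 1 := by simpa using hmm
      obtain ⟨h1, h2, h3⟩ := hS m hmm'
      have h4 := hm m hmm'
      have h5 : (m + 2) * p = m * p + 2 * p := by ring
      rw [Finset.mem_coe, B, Finset.mem_filter, Finset.mem_range]
      simp only [← hpdef]
      exact ⟨by omega, by omega, by omega, h3⟩
    · intro m hmm l hll heq
      obtain ⟨h1, h2, _⟩ := hS m (by simpa using hmm)
      obtain ⟨h3, h4, _⟩ := hS l (by simpa using hll)
      have heq' : S m = S l := by simpa using heq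
      rcases lt_trichotomy m l with hl | hl | hl
      · have : (m + 1) * p ≤ l * p := Nat.mul_le_mul_right _ hl
        have : (m + 1) * p = m * p + p := by ring
        omega
      · exact hl
      · have : (l + 1) * p ≤ m * p := Nat.mul_le_mul_right _ hl
        have : (l + 1) * p = l * p + p := by ring
        omega
  simpa using this

theorem exponent_le [LinearOrder α] (u : List α) (i j : ℕ) (h : IsRun u i j) :
    exponent u i j ≤ 3 * ((B u (i, j)).card : ℚ) := by
  have hc := B_card u i j h
  have h' := h.runP
  rw [exponent]
  set p := minPeriod (factor u i j) with hpdef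
  have hp := h'.hp
  have hlen := h'.hlen
  have hij := h'.hij
  set c := (B u (i, j)).card
  have h2 : 2 ≤ (j - i + 1) / p := (Nat.le_div_iff_mul_le hp).2 hlen
  have h3 : j - i + 1 < ((j - i + 1) / p + 1) * p := by
    have := Nat.lt_div_mul_add (a := j - i + 1) hp
    linarith
  have h4 : j - i + 1 ≤ 3 * c * p :=
    h3.le.trans (Nat.mul_le_mul_right _ (by omega))
  have h5 : (j : ℚ) - i + 1 ≤ 3 * c * p := by
    have : ((j - i + 1 : ℕ) : ℚ) ≤ ((3 * c * p : ℕ) : ℚ) := by exact_mod_cast h4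
    push_cast [Nat.cast_sub hij] at this
    exact this
  rw [div_le_iff₀ (by exact_mod_cast hp)]
  exact h5

theorem sigma_le [LinearOrder α] (u : List α) : sigma u ≤ 3 * (u.length : ℚ) := by
  have hrun : ∀ q ∈ runs u, IsRun u q.1 q.2 := fun q hq => (Finset.mem_filter.1 hq).2
  have h1 : ∑ q ∈ runs u, (B u q).card ≤ u.length := by
    rw [← Finset.card_biUnion]
    · calc _ ≤ (Finset.range u.length).card := by
            apply Finset.card_le_card
            intro s hs
            obtain ⟨q, _, hq⟩ := Finset.mem_biUnion.1 hs
            exact (Finset.mem_filter.1 hq).1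
        _ = _ := Finset.card_range _
    · intro q hq r hr hne
      refine Finset.disjoint_left.2 fun s hs hs' => hne ?_
      exact B_disjoint u q r (hrun q hq) (hrun r hr) s hs hs'
  calc sigma u ≤ ∑ q ∈ runs u, 3 * ((B u q).card : ℚ) :=
        Finset.sum_le_sum fun q hq => exponent_le u q.1 q.2 (hrun q hq)
    _ = 3 * ((∑ q ∈ runs u, (B u q).card : ℕ) : ℚ) := by
        rw [← Finset.mul_sum]; push_cast; rfl
    _ ≤ _ := by
        have : ((∑ q ∈ runs u, (B u q).card : ℕ) : ℚ) ≤ (u.length : ℚ) := by exact_mod_cast h1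
        linarith

end Words

/-- Assuming the bound `ρ(v) ≤ 1.029 |v|` on the number of runs, the sum of
exponents of runs in any word of length `n ≥ 1` is less than `4.1 n`. -/
theorem sigma_lt_four_point_one [LinearOrder α]
    (hrho : ∀ v : List α, ((runs v).card : ℚ) ≤ (1.029 : ℚ) * (v.length : ℚ))
    (u : List α) (hn : 1 ≤ u.length) :
    sigma u < (4.1 : ℚ) * (u.length : ℚ) := by
  have h := sigma_le u
  have hn' : (1 : ℚ) ≤ (u.length : ℚ) := by exact_mod_cast hn
  have : (4.1 : ℚ) = 41 / 10 := by norm_num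
  rw [this]
  linarith
end RunsExp
end

section
/- Assume that every word u of length n over a finite alphabet contains at most 0.5·n cubic runs (the bound of Crochemore, Iliopoulos, Kubica, Radoszewski, Rytter and Waleń). Then for every word u of length n ≥ 1, the sum of the exponents of all cubic runs in u is strictly less than 2.5·n. -/
open scoped Classical

namespace RunsExp

variable {α : Type*}

theorem lex_append_right_aux [LinearOrder α] : ∀ (s t z : List α), s.length = t.length →
    s < t → s ++ z < t ++ z
  | [], [], z, _, h => absurd h (lt_irrefl _)
  | [], _ :: _, z, hl, _ => by simp at hl
  | _ :: _, [], z, hl, _ => by simp at hl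
  | a :: s, b :: t, z, hl, h => by
    rw [List.cons_lt_cons_iff] at h
    rw [List.cons_append, List.cons_append, List.cons_lt_cons_iff]
    rcases h with h | ⟨h, h'⟩
    · exact Or.inl h
    · exact Or.inr ⟨h, lex_append_right_aux s t z (by simpa using hl) h'⟩

theorem lex_append_left_aux [LinearOrder α] : ∀ (z s t : List α),
    s < t → z ++ s < z ++ t
  | [], s, t, h => h
  | a :: z, s, t, h => by
    rw [List.cons_append, List.cons_append, List.cons_lt_cons_iff]
    exact Or.inr ⟨rfl, lex_append_left_aux z s t h⟩

/-- A border of a minimal rotation gives a nontrivial rotation fixing the word. -/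
theorem rotate_eq_of_border [LinearOrder α] (v : List α) (hv : ∀ b, v ≤ v.rotate b)
    (b : ℕ) (hb : b < v.length)
    (h : ∀ x, x < b → v[x]? = v[v.length - b + x]?) : v.rotate b = v := by
  have hz : v.take b = v.drop (v.length - b) := by
    apply List.ext_getElem?
    intro x
    rw [List.getElem?_take, List.getElem?_drop]
    split_ifs with hx
    · exact h x hx
    · rw [List.getElem?_eq_none (by omega)]
  have r1 : v.rotate b = v.drop b ++ v.take b := List.rotate_eq_drop_append_take hb.le
  have r2 : v.rotate (v.length - b) = v.take b ++ v.take (v.length - b) := by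
    rw [List.rotate_eq_drop_append_take (by omega), hz]
  have e1 : v = v.take b ++ v.drop b := (List.take_append_drop _ _).symm
  have e2 : v = v.take (v.length - b) ++ v.take b := by
    rw [hz]; exact (List.take_append_drop _ _).symm
  have hst : v.drop b = v.take (v.length - b) := by
    rcases lt_trichotomy (v.drop b) (v.take (v.length - b)) with hl | he | hg
    · have := lex_append_right_aux _ _ (v.take b) (by simp) hl
      rw [← r1, ← e2] at this
      exact absurd (hv b) (not_le.2 this)
    · exact he
    · have := lex_append_left_aux (v.take b) _ _ hg
      rw [← r2, ← e1] at this
      exact absurd (hv _) (not_le.2 this)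
  rw [r1, hst]; exact e2.symm

theorem exists_unbordered_rotation [LinearOrder α] (w : List α) (hw : 0 < w.length)
    (hprim : ∀ b, 0 < b → b < w.length → w.rotate b ≠ w) :
    ∃ a, a < w.length ∧ ∀ b, 0 < b → b < w.length → ∃ x, x < b ∧
      w[(x + a) % w.length]? ≠ w[(w.length - b + x + a) % w.length]? := by
  obtain ⟨a, ha, hmin⟩ := Finset.exists_min_image (Finset.range w.length) (fun a => w.rotate a)
    ⟨0, by simpa using hw⟩
  refine ⟨a, by simpa using ha, fun b hb0 hb => ?_⟩
  by_contra! hcon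
  have key := rotate_eq_of_border (w.rotate a) (fun c => by
    rw [List.rotate_rotate, ← List.rotate_mod w (a + c)]
    exact hmin ((a + c) % w.length) (Finset.mem_range.2 (Nat.mod_lt _ hw))) b (by simpa using hb) (fun x hx => by
      rw [List.length_rotate, List.getElem?_rotate (by omega), List.getElem?_rotate (by omega)]
      exact hcon x hx)
  rw [List.rotate_rotate, Nat.add_comm, ← List.rotate_rotate] at key
  exact hprim b hb0 hb (List.rotate_injective a key)

theorem factor_getElem? (u : List α) (i j x : ℕ) (hx : x < j - i + 1) :
    (factor u i j)[x]? = u[i + x]? := by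
  rw [factor, List.getElem?_take, if_pos hx, List.getElem?_drop]

theorem minPeriod_spec (u : List α) (i j : ℕ) (hij : i ≤ j) (hj : j < u.length) :
    0 < minPeriod (factor u i j) ∧
    (∀ x, i ≤ x → x + minPeriod (factor u i j) ≤ j →
      u[x]? = u[x + minPeriod (factor u i j)]?) ∧
    (∀ q, 0 < q → (∀ x, i ≤ x → x + q ≤ j → u[x]? = u[x + q]?) →
      minPeriod (factor u i j) ≤ q) := by
  have hl := factor_length u i j hij hj
  have hne : {p | IsPeriod (factor u i j) p}.Nonempty :=
    ⟨j - i + 1, by omega, fun x hx => by omega⟩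
  have hm : IsPeriod (factor u i j) (minPeriod (factor u i j)) := Nat.sInf_mem hne
  refine ⟨hm.1, fun x hx hxj => ?_, fun q hq h => Nat.sInf_le ⟨hq, fun x hx => ?_⟩⟩
  · have := hm.2 (x - i) (by omega)
    rw [factor_getElem? _ _ _ _ (by omega), factor_getElem? _ _ _ _ (by omega)] at this
    rw [show i + (x - i) = x by omega,
      show i + (x - i + minPeriod (factor u i j)) = x + minPeriod (factor u i j) by omega] at this
    exact this
  · rw [factor_getElem? _ _ _ _ (by omega), factor_getElem? _ _ _ _ (by omega), ← Nat.add_assoc]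
    exact h _ (by omega) (by omega)

/-- The word `u` has an unbordered factor of length `p` starting at position `k`. -/
def UnbAt (u : List α) (k p : ℕ) : Prop :=
  ∀ b, 0 < b → b < p → ∃ x, x < b ∧ u[k + x]? ≠ u[k + (p - b) + x]?

theorem exists_unbAt [LinearOrder α] (u : List α) (i j : ℕ) (hij : i ≤ j) (hj : j < u.length)
    (h2 : 2 * minPeriod (factor u i j) ≤ j - i + 1) :
    ∃ a, a < minPeriod (factor u i j) ∧
      ∀ m, a + (m + 1) * minPeriod (factor u i j) ≤ j - i + 1 →
        UnbAt u (i + a + m * minPeriod (factor u i j)) (minPeriod (factor u i j)) := by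
  obtain ⟨hp, hper, hmin⟩ := minPeriod_spec u i j hij hj
  generalize minPeriod (factor u i j) = p at *
  obtain ⟨w, hw⟩ : ∃ w, w = factor u i (i + p - 1) := ⟨_, rfl⟩
  have hwl : w.length = p := by rw [hw, factor_length _ _ _ (by omega) (by omega)]; omega
  have hwu : ∀ x, i + x ≤ j → u[i + x]? = w[x % p]? := by
    intro x
    induction x using Nat.strong_induction_on with
    | _ x ih =>
      intro hx
      by_cases hxp : x < p
      · rw [Nat.mod_eq_of_lt hxp, hw, factor_getElem? _ _ _ _ (by omega)]
      · have h1 := hper (i + (x - p)) (by omega) (by omega)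
        rw [show i + (x - p) + p = i + x by omega] at h1
        rw [← h1, ih (x - p) (by omega) (by omega), Nat.mod_eq_sub_mod (by omega : x ≥ p)]
  have hprim : ∀ b, 0 < b → b < w.length → w.rotate b ≠ w := by
    intro b hb0 hb he
    have := hmin b hb0 (fun x hx hxj => by
      have e1 := hwu (x - i) (by omega)
      have e2 := hwu (x - i + b) (by omega)
      rw [show i + (x - i) = x by omega] at e1
      rw [show i + (x - i + b) = x + b by omega] at e2
      rw [e1, e2]
      conv_lhs => rw [← he]
      rw [List.getElem?_rotate (by rw [hwl]; exact Nat.mod_lt _ hp), hwl, Nat.mod_add_mod])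
    omega
  obtain ⟨a, ha, hu⟩ := exists_unbordered_rotation w (by omega) hprim
  rw [hwl] at ha hu
  refine ⟨a, ha, fun m hm b hb0 hb => ?_⟩
  obtain ⟨x, hx, hne⟩ := hu b hb0 hb
  refine ⟨x, hx, ?_⟩
  have hm' : a + m * p + p ≤ j - i + 1 := by rw [Nat.add_mul] at hm; omega
  rw [show i + a + m * p + x = i + (x + a + m * p) by omega,
    show i + a + m * p + (p - b) + x = i + (p - b + x + a + m * p) by omega,
    hwu _ (by omega), hwu _ (by omega), Nat.add_mul_mod_self_right, Nat.add_mul_mod_self_right]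
  exact hne

/-- Centers of squares of unbordered roots of the run `[i..j]`. -/
noncomputable def centers (u : List α) (i j : ℕ) : Finset ℕ :=
  (Finset.Icc 1 (u.length - 1)).filter fun k =>
    i + minPeriod (factor u i j) ≤ k ∧ k + minPeriod (factor u i j) ≤ j + 1 ∧
      UnbAt u k (minPeriod (factor u i j))

theorem card_centers [LinearOrder α] (u : List α) (i j : ℕ) (hr : IsCubicRun u i j) :
    exponent u i j - 3 ≤ ((centers u i j).card : ℚ) := by
  obtain ⟨⟨hij, hj, h2, -, -⟩, h3⟩ := hr
  obtain ⟨hp, -, -⟩ := minPeriod_spec u i j hij hj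
  obtain ⟨a, ha, hu⟩ := exists_unbAt u i j hij hj h2
  unfold exponent centers
  generalize minPeriod (factor u i j) = p at *
  obtain ⟨M, hM⟩ : ∃ M, M = (j - i + 1) / p - 2 := ⟨_, rfl⟩
  have hd3 : 3 ≤ (j - i + 1) / p := (Nat.le_div_iff_mul_le hp).2 h3
  have hM1 : (M + 2) * p ≤ j - i + 1 := by
    rw [show M + 2 = (j - i + 1) / p by omega]; exact Nat.div_mul_le_self _ _
  have hM2 : j - i + 1 < (M + 3) * p := by
    rw [show M + 3 = (j - i + 1) / p + 1 by omega, Nat.mul_comm]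
    exact Nat.lt_mul_div_succ _ hp
  have hcard : M ≤ ((Finset.Icc 1 (u.length - 1)).filter fun k =>
      i + p ≤ k ∧ k + p ≤ j + 1 ∧ UnbAt u k p).card := by
    have : M = (Finset.Icc 1 M).card := by simp
    rw [this]
    apply Finset.card_le_card_of_injOn (fun m => i + a + m * p)
    · intro m hm
      simp only [Finset.coe_Icc, Set.mem_Icc] at hm
      have h1 : m * p ≤ M * p := Nat.mul_le_mul_right _ hm.2
      have h1' : 1 * p ≤ m * p := Nat.mul_le_mul_right _ hm.1
      have h4 : (M + 2) * p = M * p + 2 * p := Nat.add_mul _ _ _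
      simp only [Finset.coe_filter, Finset.mem_Icc, Set.mem_ofPred_eq]
      refine ⟨by omega, by omega, by omega, hu m ?_⟩
      rw [Nat.add_mul]; omega
    · intro m _ m' _ he
      simp only at he
      exact Nat.eq_of_mul_eq_mul_right hp (by omega)
  have hMq : (M : ℚ) ≤ _ := Nat.cast_le.2 hcard
  refine le_trans ?_ hMq
  have hpq : (0 : ℚ) < p := by exact_mod_cast hp
  rw [sub_le_iff_le_add, div_le_iff₀ hpq]
  have : ((j - i + 1 : ℕ) : ℚ) < ((M + 3) * p : ℕ) := by exact_mod_cast hM2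
  push_cast [Nat.cast_sub hij] at this
  exact this.le

theorem period_le_of_common (u : List α) (i j p q k : ℕ) (hp : 0 < p)
    (hper : ∀ x, i ≤ x → x + p ≤ j → u[x]? = u[x + p]?)
    (h1 : i + p ≤ k) (h2 : k + p ≤ j + 1)
    (i' j' : ℕ) (hper' : ∀ x, i' ≤ x → x + q ≤ j' → u[x]? = u[x + q]?)
    (h1' : i' + q ≤ k) (h2' : k + q ≤ j' + 1) (hu : UnbAt u k q) : q ≤ p := by
  by_contra! hlt
  obtain ⟨x, hx, hne⟩ := hu p hp hlt
  apply hne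
  have e1 := hper (k - p + x) (by omega) (by omega)
  have e2 := hper' (k - p + x) (by omega) (by omega)
  rw [show k - p + x + p = k + x by omega] at e1
  rw [show k - p + x + q = k + (q - p) + x by omega] at e2
  rw [← e1, e2]

theorem run_eq_of_common (u : List α) (i j i' j' k : ℕ) (hr : IsRun u i j) (hr' : IsRun u i' j')
    (hk : k ∈ centers u i j) (hk' : k ∈ centers u i' j') : i = i' ∧ j = j' := by
  obtain ⟨hij, hj, -, hL, hR⟩ := hr
  obtain ⟨hij', hj', -, hL', hR'⟩ := hr'
  obtain ⟨hp, hper, -⟩ := minPeriod_spec u i j hij hj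
  obtain ⟨hp', hper', -⟩ := minPeriod_spec u i' j' hij' hj'
  simp only [centers, Finset.mem_filter] at hk hk'
  obtain ⟨-, a1, a2, a3⟩ := hk
  obtain ⟨-, b1, b2, b3⟩ := hk'
  have c1 := period_le_of_common u i j _ _ k hp hper a1 a2 i' j' hper' b1 b2 b3
  have c2 := period_le_of_common u i' j' _ _ k hp' hper' b1 b2 i j hper a1 a2 a3
  have hpp := le_antisymm c2 c1
  clear c1 c2
  generalize minPeriod (factor u i j) = p at *
  generalize minPeriod (factor u i' j') = p' at *
  subst hpp
  refine ⟨?_, ?_⟩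
  · rcases lt_trichotomy i i' with h | h | h
    · rcases hL' with h0 | h0
      · omega
      · exact absurd (by
          have := hper (i' - 1) (by omega) (by omega)
          rwa [show i' - 1 + p = i' + p - 1 by omega] at this) h0
    · exact h
    · rcases hL with h0 | h0
      · omega
      · exact absurd (by
          have := hper' (i - 1) (by omega) (by omega)
          rwa [show i - 1 + p = i + p - 1 by omega] at this) h0
  · rcases lt_trichotomy j j' with h | h | h
    · rcases hR with h0 | h0
      · omega
      · exact absurd (by
          have := hper' (j - p + 1) (by omega) (by omega)
          rwa [show j - p + 1 + p = j + 1 by omega] at this) h0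
    · exact h
    · rcases hR' with h0 | h0
      · omega
      · exact absurd (by
          have := hper (j' - p + 1) (by omega) (by omega)
          rwa [show j' - p + 1 + p = j' + 1 by omega] at this) h0

/-- Assuming the bound `ρ_cubic(v) ≤ 0.5 |v|` on the number of cubic runs, the sum
of exponents of cubic runs in any word of length `n ≥ 1` is less than `2.5 n`. -/
theorem sigmaCubic_lt_two_point_five [LinearOrder α]
    (hrho : ∀ v : List α, ((cubicRuns v).card : ℚ) ≤ (0.5 : ℚ) * (v.length : ℚ))
    (u : List α) (hn : 1 ≤ u.length) :
    sigmaCubic u < (2.5 : ℚ) * (u.length : ℚ) := by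
  have hsub : ∑ q ∈ cubicRuns u, (centers u q.1 q.2).card ≤ u.length - 1 := by
    rw [← Finset.card_biUnion]
    · calc _ ≤ (Finset.Icc 1 (u.length - 1)).card := by
            apply Finset.card_le_card
            intro k hk
            obtain ⟨q, -, hq⟩ := Finset.mem_biUnion.1 hk
            exact (Finset.mem_filter.1 hq).1
        _ = _ := by simp
    · intro q hq q' hq' hne
      rw [Function.onFun, Finset.disjoint_left]
      intro k hk hk'
      have hr := (Finset.mem_filter.1 hq).2
      have hr' := (Finset.mem_filter.1 hq').2
      obtain ⟨h1, h2⟩ := run_eq_of_common u _ _ _ _ k hr.1 hr'.1 hk hk'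
      exact hne (Prod.ext h1 h2)
  have h1 : ∑ q ∈ cubicRuns u, (exponent u q.1 q.2 - 3) ≤
      ∑ q ∈ cubicRuns u, ((centers u q.1 q.2).card : ℚ) :=
    Finset.sum_le_sum fun q hq => card_centers u _ _ (Finset.mem_filter.1 hq).2
  have h2 : ∑ q ∈ cubicRuns u, ((centers u q.1 q.2).card : ℚ) ≤ (u.length : ℚ) - 1 := by
    have : ((∑ q ∈ cubicRuns u, (centers u q.1 q.2).card : ℕ) : ℚ) ≤ ((u.length - 1 : ℕ) : ℚ) := by
      exact_mod_cast hsub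
    rw [Nat.cast_sub hn] at this
    push_cast at this
    exact this
  rw [Finset.sum_sub_distrib, Finset.sum_const, nsmul_eq_mul] at h1
  have h3 := hrho u
  unfold sigmaCubic
  norm_num at h3 ⊢
  linarith
end RunsExp
end
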